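/- For every odd integer n ≥ 3, Σ_{0 ≤ k ≤ n, k ≡ 3 (mod 6)} C(n,k) 4^k B_{n-k} equals (n/3)(1 + 2^{n-1} + 3^{n-1} − 2^{2n-3} − (−12)^{(n-1)/2} − V_{n-1}(2,13)) if n ≡ 1 (mod 6), and equals (n/3)(1 + 2^{n-1} + 3^{n-1} + 4^{n-1} − (−12)^{(n-1)/2} − V_{n-1}(2,13)) if n ≢ 1 (mod 6). -/

import Mathlib

open Finset

/-- The Lucas sequence `V_n(b,c)`: `V_0 = 2`, `V_1 = b`, `V_{n+2} = b V_{n+1} - c V_n`. -/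
def lucasV (b c : ℚ) : ℕ → ℚ
  | 0 => 2
  | 1 => b
  | n + 2 => b * lucasV b c (n + 1) - c * lucasV b c n

section AevalBernoulli

variable {A : Type*} [CommRing A] [Algebra ℚ A]

theorem aeval_bernoulli_add_one (n : ℕ) (x : A) :
    Polynomial.aeval (x + 1) (Polynomial.bernoulli n) =
      Polynomial.aeval x (Polynomial.bernoulli n) + n * x ^ (n - 1) := by
  have h := congrArg (Polynomial.aeval x) (Polynomial.bernoulli_comp_one_add_X n)
  simpa [Polynomial.aeval_comp, add_comm] using h

theorem aeval_bernoulli_add_natCast (n k : ℕ) (x : A) :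
    Polynomial.aeval (x + k) (Polynomial.bernoulli n) =
      Polynomial.aeval x (Polynomial.bernoulli n) + n * ∑ i ∈ range k, (x + i) ^ (n - 1) := by
  induction k with
  | zero => simp
  | succ k ih =>
    rw [Nat.cast_succ, ← add_assoc, aeval_bernoulli_add_one, ih, sum_range_succ]
    ring

theorem aeval_bernoulli_neg {n : ℕ} (hn : Odd n) (x : A) :
    Polynomial.aeval (-x) (Polynomial.bernoulli n) =
      -(Polynomial.aeval x (Polynomial.bernoulli n) + n * x ^ (n - 1)) := by
  have h := congrArg (Polynomial.aeval x) (Polynomial.bernoulli_comp_neg_X n)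
  simpa [Polynomial.aeval_comp, hn.neg_one_pow, add_comm] using h

theorem aeval_bernoulli_one_sub {n : ℕ} (hn : Odd n) (x : A) :
    Polynomial.aeval (1 - x) (Polynomial.bernoulli n) =
      -Polynomial.aeval x (Polynomial.bernoulli n) := by
  have h := congrArg (Polynomial.aeval x) (Polynomial.bernoulli_comp_one_sub_X n)
  simpa [Polynomial.aeval_comp, hn.neg_one_pow] using h

theorem aeval_bernoulli_eq_sum (n : ℕ) (x : A) :
    Polynomial.aeval x (Polynomial.bernoulli n) =
      ∑ k ∈ range (n + 1), algebraMap ℚ A (n.choose k * bernoulli (n - k)) * x ^ k := by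
  simp [Polynomial.bernoulli_def, Polynomial.aeval_monomial, mul_comm]

end AevalBernoulli

theorem algebraMap_lucasV_eq_pow_add_pow {A : Type*} [CommRing A] [Algebra ℚ A] {b c : ℚ} {x y : A}
    (hb : x + y = algebraMap ℚ A b) (hc : x * y = algebraMap ℚ A c) (n : ℕ) :
    algebraMap ℚ A (lucasV b c n) = x ^ n + y ^ n := by
  induction n using Nat.twoStepInduction with
  | zero => rw [lucasV, map_ofNat, pow_zero, pow_zero, one_add_one_eq_two]
  | one => simp [lucasV, hb]
  | more n ih₀ ih₁ =>
    rw [lucasV, map_sub, map_mul, map_mul, ih₀, ih₁, ← hb, ← hc]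
    ring

section CubeRoot

variable {A : Type*} [CommRing A] {w : A}

theorem pow_three_eq_one_of_sq_add_self_add_one (hw : w ^ 2 + w + 1 = 0) : w ^ 3 = 1 := by
  linear_combination (w - 1) * hw

theorem one_add_pow_add_sq_pow (hw : w ^ 2 + w + 1 = 0) (k : ℕ) :
    1 + w ^ k + (w ^ 2) ^ k = if k % 3 = 0 then 3 else 0 := by
  have h3 := pow_three_eq_one_of_sq_add_self_add_one hw
  have hk : w ^ k = w ^ (k % 3) := pow_eq_pow_mod k h3
  rw [← pow_mul, mul_comm, pow_mul, hk]
  have : k % 3 < 3 := Nat.mod_lt _ (by norm_num)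
  interval_cases k % 3
  · norm_num
  · simp only [one_ne_zero, if_false]
    linear_combination hw
  · simp only [OfNat.ofNat_ne_zero, if_false]
    linear_combination (w ^ 2 - w + 1) * hw

/-- The sixth roots of unity filter selecting the exponents `k ≡ 3 (mod 6)`. -/
theorem one_sub_neg_one_pow_mul_one_add_pow_add_sq_pow (hw : w ^ 2 + w + 1 = 0) (k : ℕ) :
    (1 - (-1) ^ k) * (1 + w ^ k + (w ^ 2) ^ k) = if k % 6 = 3 then 6 else 0 := by
  rw [one_add_pow_add_sq_pow hw]
  rcases Nat.even_or_odd k with h | h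
  · have h6 : k % 6 ≠ 3 := by grind
    simp [h.neg_one_pow, h6]
  · have h6 : k % 6 = 3 ↔ k % 3 = 0 := by grind
    simp only [h.neg_one_pow, h6]
    split_ifs <;> norm_num

/-- The sum over `k ≡ 3 (mod 6)`, written through the odd parts of the Bernoulli polynomial at
`x`, `w x` and `w² x`. -/
theorem algebraMap_six_mul_sum_filter_mod_six [Algebra ℚ A] (hw : w ^ 2 + w + 1 = 0) (n : ℕ)
    (x : ℚ) (f : A → A)
    (hf : ∀ y, f y = Polynomial.aeval y (Polynomial.bernoulli n) -
      Polynomial.aeval (-y) (Polynomial.bernoulli n)) :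
    algebraMap ℚ A (6 * ∑ k ∈ (range (n + 1)).filter (fun k => k % 6 = 3),
        (n.choose k : ℚ) * x ^ k * bernoulli (n - k)) =
      f (algebraMap ℚ A x) + f (w * algebraMap ℚ A x) + f (w ^ 2 * algebraMap ℚ A x) := by
  simp only [hf, aeval_bernoulli_eq_sum, ← sum_sub_distrib, ← sum_add_distrib]
  rw [sum_filter, mul_sum, map_sum]
  refine sum_congr rfl fun k _ => ?_
  have h := one_sub_neg_one_pow_mul_one_add_pow_add_sq_pow hw k
  rw [neg_pow (algebraMap ℚ A x), neg_pow (w * _), neg_pow (w ^ 2 * _), mul_pow, mul_pow]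
  trans algebraMap ℚ A (n.choose k * bernoulli (n - k)) * (algebraMap ℚ A x) ^ k *
    ((1 - (-1) ^ k) * (1 + w ^ k + (w ^ 2) ^ k))
  · rw [h]
    split_ifs
    · simp only [map_mul, map_pow, map_ofNat]
      ring
    · simp
  · ring

end CubeRoot

theorem aeval_bernoulli_four {A : Type*} [CommRing A] [Algebra ℚ A] {n : ℕ} (hn : 3 ≤ n)
    (hodd : Odd n) :
    Polynomial.aeval (4 : A) (Polynomial.bernoulli n) =
      n * (1 + 2 ^ (n - 1) + 3 ^ (n - 1)) := by
  have h := aeval_bernoulli_add_natCast n 4 (0 : A)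
  have h0 : Polynomial.aeval (0 : A) (Polynomial.bernoulli n) = 0 := by
    rw [← map_zero (algebraMap ℚ A), Polynomial.aeval_algebraMap_apply]
    simp [bernoulli_eq_zero_of_odd hodd (by lia)]
  have hn1 : n - 1 ≠ 0 := by lia
  rw [h0] at h
  simpa [sum_range_succ, hn1] using h

theorem aeval_bernoulli_add_conj {A : Type*} [CommRing A] [Algebra ℚ A] {s : A} (hs : s ^ 2 = -3)
    {n : ℕ} (hodd : Odd n) :
    Polynomial.aeval (-2 + 2 * s) (Polynomial.bernoulli n) +
        Polynomial.aeval (-2 - 2 * s) (Polynomial.bernoulli n) =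
      -n * ((-2 + 2 * s) ^ (n - 1) + (-2 - 2 * s) ^ (n - 1) + (-12) ^ ((n - 1) / 2) +
        algebraMap ℚ A (lucasV 2 13 (n - 1))) := by
  have hV := algebraMap_lucasV_eq_pow_add_pow (A := A) (b := 2) (c := 13) (x := 1 + 2 * s)
    (y := 1 - 2 * s) (by rw [map_ofNat]; ring)
    (by rw [map_ofNat]; linear_combination -4 * hs) (n - 1)
  have h := aeval_bernoulli_add_natCast n 5 (-2 - 2 * s)
  have h1 := aeval_bernoulli_one_sub hodd (-2 + 2 * s)
  have hx : 1 - (-2 + 2 * s) = -2 - 2 * s + (5 : ℕ) := by push_cast; ring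
  rw [hx, h] at h1
  have hev : Even (n - 1) := by grind
  have e1 : (-2 - 2 * s + 1) ^ (n - 1) = (1 + 2 * s) ^ (n - 1) := by
    rw [← hev.neg_pow]; ring
  have e2 : (-2 - 2 * s + 2) ^ (n - 1) = (-12) ^ ((n - 1) / 2) := by
    nth_rewrite 1 [← Nat.two_mul_div_two_of_even hev]
    rw [pow_mul]
    congr 1
    linear_combination 4 * hs
  have e3 : (-2 - 2 * s + 3) ^ (n - 1) = (1 - 2 * s) ^ (n - 1) := by ring
  have e4 : (-2 - 2 * s + 4) ^ (n - 1) = (-2 + 2 * s) ^ (n - 1) := by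
    rw [← hev.neg_pow]; ring
  simp only [sum_range_succ, sum_range_zero, Nat.cast_zero, Nat.cast_one, Nat.cast_ofNat, e1, e2,
    e3, e4] at h1
  rw [hV]
  linear_combination h1

theorem sum_choose_four_pow_bernoulli_mod_six (n : ℕ) (hn : 3 ≤ n) (hodd : Odd n) :
    ∑ k ∈ (Finset.range (n + 1)).filter (fun k => k % 6 = 3),
      (n.choose k : ℚ) * 4 ^ k * bernoulli (n - k)
    = if n % 6 = 1 then
        (n : ℚ) / 3 * (1 + 2 ^ (n - 1) + 3 ^ (n - 1) - 2 ^ (2 * n - 3)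
          - (-12 : ℚ) ^ ((n - 1) / 2) - lucasV 2 13 (n - 1))
      else
        (n : ℚ) / 3 * (1 + 2 ^ (n - 1) + 3 ^ (n - 1) + 4 ^ (n - 1)
          - (-12 : ℚ) ^ ((n - 1) / 2) - lucasV 2 13 (n - 1)) := by
  obtain ⟨s, hs⟩ := IsAlgClosed.exists_pow_nat_eq (-3 : ℂ) (n := 2) (by norm_num)
  set w : ℂ := (-1 + s) / 2 with hwdef
  have hw : w ^ 2 + w + 1 = 0 := by rw [hwdef]; linear_combination hs / 4
  have hu : w * algebraMap ℚ ℂ 4 = -2 + 2 * s := by rw [map_ofNat, hwdef]; ring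
  have hv : w ^ 2 * algebraMap ℚ ℂ 4 = -2 - 2 * s := by
    rw [map_ofNat, hwdef]; linear_combination hs
  have hsum := algebraMap_six_mul_sum_filter_mod_six hw n 4
    (fun y => 2 * Polynomial.aeval y (Polynomial.bernoulli n) + n * y ^ (n - 1))
    (fun y => by rw [aeval_bernoulli_neg hodd]; ring)
  have hpow := one_add_pow_add_sq_pow hw (n - 1)
  have hup : (-2 + 2 * s) ^ (n - 1) = w ^ (n - 1) * 4 ^ (n - 1) := by
    rw [← hu, mul_pow, map_ofNat]
  have hvp : (-2 - 2 * s) ^ (n - 1) = (w ^ 2) ^ (n - 1) * 4 ^ (n - 1) := by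
    rw [← hv, mul_pow, map_ofNat]
  have hconj := aeval_bernoulli_add_conj hs hodd
  simp only [hu, hv] at hsum
  rw [map_ofNat, aeval_bernoulli_four hn hodd] at hsum
  rw [hup, hvp] at hconj hsum
  have h4 : (4 : ℂ) ^ (n - 1) = 2 * 2 ^ (2 * n - 3) := by
    rw [← pow_succ', show 2 * n - 3 + 1 = 2 * (n - 1) by lia, pow_mul]
    norm_num
  apply (algebraMap ℚ ℂ).injective
  rw [map_mul, map_ofNat] at hsum
  have h6 : n % 6 = 1 ↔ (n - 1) % 3 = 0 := by grind
  simp only [h6]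
  split_ifs at hpow ⊢
  · simp only [map_sub, map_add, map_mul, map_pow, map_div₀, map_ofNat, map_neg, map_natCast,
      map_one] at hsum ⊢
    linear_combination hsum / 6 + hconj / 3 - n * 4 ^ (n - 1) / 6 * hpow - n / 6 * h4
  · simp only [map_sub, map_add, map_mul, map_pow, map_div₀, map_ofNat, map_neg, map_natCast,
      map_one] at hsum ⊢
    linear_combination hsum / 6 + hconj / 3 - n * 4 ^ (n - 1) / 6 * hpow
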